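/- arXiv:2411.05385 — 3 statements merged into one kernel-verified Lean document; each statement's English description precedes it below -/
import Mathlib

section
/- Let K ∈ ℂ^{n×n} with n = n₁+⋯+n_d. Let L be a nonzero positive semidefinite element of 𝒲_K^⊥, factored as L = XX* with X ∈ ℂ^{n×m} where m = rank(L), write X = col(X₁,…,X_d) and K*X = col(Y₁,…,Y_d) with X_j, Y_j ∈ ℂ^{n_j×m}. Then L generates an extreme ray of the cone 𝒲_K^⊥ ∩ PSD if and only if the intersection ∩_{j=1}^d ker(conj(X_j) ⊗ X_j − conj(Y_j) ⊗ Y_j) ⊆ ℂ^{m²} has dimension 1. -/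
open Matrix Kronecker
open scoped ComplexOrder

/-- The index type for the block decomposition `n = n₁ + ⋯ + n_d`:
`BIdx nn ≃ Fin (n₁ + ⋯ + n_d)`. -/
abbrev BIdx {d : ℕ} (nn : Fin d → ℕ) : Type := (j : Fin d) × Fin (nn j)

/-- The real subspace `𝒲_K = {⊕_j H_j − K (⊕_j H_j) K* : H_j Hermitian}` of `ℋ_n`. -/
def WK {d : ℕ} (nn : Fin d → ℕ) (K : Matrix (BIdx nn) (BIdx nn) ℂ) :
    Set (Matrix (BIdx nn) (BIdx nn) ℂ) :=
  { W | ∃ H : ∀ j : Fin d, Matrix (Fin (nn j)) (Fin (nn j)) ℂ,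
      (∀ j, (H j).IsHermitian) ∧
      W = Matrix.blockDiagonal' H - K * Matrix.blockDiagonal' H * Kᴴ }

/-- The orthogonal complement `𝒲_K^⊥` of `𝒲_K` inside the Hermitian matrices `ℋ_n`,
with respect to the trace inner product `⟨A,B⟩ = Tr(AB)`. -/
def WKperp {d : ℕ} (nn : Fin d → ℕ) (K : Matrix (BIdx nn) (BIdx nn) ℂ) :
    Set (Matrix (BIdx nn) (BIdx nn) ℂ) :=
  { L | L.IsHermitian ∧ ∀ W ∈ WK nn K, Matrix.trace (L * W) = 0 }

/-- The `j`-th block `X_j ∈ ℂ^{n_j × m}` of `X = col(X₁,…,X_d) ∈ ℂ^{n × m}`. -/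
def blk {d : ℕ} (nn : Fin d → ℕ) {m : ℕ} (X : Matrix (BIdx nn) (Fin m) ℂ)
    (j : Fin d) : Matrix (Fin (nn j)) (Fin m) ℂ :=
  fun a k => X ⟨j, a⟩ k

/-- A nonzero `L ∈ C` generates an extreme ray of the convex cone `C` if whenever
`L = L₁ + L₂` with `L₁, L₂ ∈ C`, both `L₁` and `L₂` are real scalar multiples of `L`. -/
def GeneratesExtremeRay {ι : Type*} (C : Set (Matrix ι ι ℂ)) (L : Matrix ι ι ℂ) : Prop :=
  L ∈ C ∧ L ≠ 0 ∧ ∀ L₁ ∈ C, ∀ L₂ ∈ C, L = L₁ + L₂ →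
    (∃ t : ℝ, L₁ = t • L) ∧ (∃ t : ℝ, L₂ = t • L)

theorem trace_mul_blockDiagonal' {d : ℕ} (nn : Fin d → ℕ)
    (D : Matrix (BIdx nn) (BIdx nn) ℂ) (H : ∀ j, Matrix (Fin (nn j)) (Fin (nn j)) ℂ) :
    trace (D * blockDiagonal' H) = ∑ j, trace (blockDiag' D j * H j) := by
  simp only [trace, Matrix.diag, Matrix.mul_apply, Fintype.sum_sigma, blockDiag'_apply]
  refine Finset.sum_congr rfl fun j _ => Finset.sum_congr rfl fun a _ => ?_
  rw [Finset.sum_eq_single j]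
  · simp
  · intro i _ hij
    exact Finset.sum_eq_zero fun b _ => by rw [blockDiagonal'_apply_ne _ _ _ hij, mul_zero]
  · simp

/-- A Hermitian matrix lies in `𝒲_K^⊥` iff the diagonal blocks of `A - K* A K` vanish. -/
theorem mem_WKperp_iff {d : ℕ} (nn : Fin d → ℕ) (K A : Matrix (BIdx nn) (BIdx nn) ℂ) :
    A ∈ WKperp nn K ↔ A.IsHermitian ∧ blockDiag' (A - Kᴴ * A * K) = 0 := by
  have key : ∀ H : ∀ j, Matrix (Fin (nn j)) (Fin (nn j)) ℂ,
      trace (A * (blockDiagonal' H - K * blockDiagonal' H * Kᴴ)) =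
        ∑ j, trace (blockDiag' (A - Kᴴ * A * K) j * H j) := by
    intro H
    rw [← trace_mul_blockDiagonal', Matrix.mul_sub, Matrix.sub_mul, trace_sub, trace_sub]
    congr 1
    rw [← Matrix.mul_assoc, trace_mul_comm]
    simp only [Matrix.mul_assoc]
  refine and_congr_right fun hA => ⟨fun h => ?_, ?_⟩
  · set B := blockDiag' (A - Kᴴ * A * K) with hB
    have hD : (A - Kᴴ * A * K).IsHermitian := hA.sub (isHermitian_conjTranspose_mul_mul K hA)
    have hH : ∀ j, (B j).IsHermitian := fun j => by
      ext a b
      exact congrFun (congrFun hD ⟨j, a⟩) ⟨j, b⟩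
    have h0 := h _ ⟨B, hH, rfl⟩
    rw [key] at h0
    have hnonneg : ∀ j ∈ Finset.univ, 0 ≤ trace (B j * B j) := fun j _ => by
      have := (posSemidef_self_mul_conjTranspose (B j)).trace_nonneg
      rwa [hH j] at this
    funext j
    have hj := (Finset.sum_eq_zero_iff_of_nonneg hnonneg).1 h0 j (Finset.mem_univ j)
    refine trace_mul_conjTranspose_self_eq_zero_iff.1 ?_
    rwa [hH j]
  · rintro h _ ⟨H, -, rfl⟩
    rw [key, h]
    simp

theorem blk_mul_mul_conjTranspose {d : ℕ} (nn : Fin d → ℕ) {m : ℕ}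
    (X : Matrix (BIdx nn) (Fin m) ℂ) (T : Matrix (Fin m) (Fin m) ℂ) (j : Fin d) :
    blk nn X j * T * (blk nn X j)ᴴ = blockDiag' (X * T * Xᴴ) j := by
  ext a b
  simp [Matrix.mul_apply, blk, blockDiag'_apply]

theorem vec_mem_iInf_ker_iff {d : ℕ} (nn : Fin d → ℕ) {m : ℕ}
    (K : Matrix (BIdx nn) (BIdx nn) ℂ) (X : Matrix (BIdx nn) (Fin m) ℂ)
    (T : Matrix (Fin m) (Fin m) ℂ) :
    vec T ∈ (⨅ j : Fin d, LinearMap.ker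
          (Matrix.mulVecLin
            (((blk nn X j).map star) ⊗ₖ (blk nn X j) -
              ((blk nn (Kᴴ * X) j).map star) ⊗ₖ (blk nn (Kᴴ * X) j)))) ↔
      blockDiag' (X * T * Xᴴ - Kᴴ * (X * T * Xᴴ) * K) = 0 := by
  rw [Submodule.mem_iInf, funext_iff]
  refine forall_congr' fun j => ?_
  have hY : Kᴴ * (X * T * Xᴴ) * K = (Kᴴ * X) * T * (Kᴴ * X)ᴴ := by
    simp [Matrix.mul_assoc]
  rw [LinearMap.mem_ker, mulVecLin_apply, sub_mulVec, kronecker_mulVec_vec, kronecker_mulVec_vec,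
    sub_eq_zero, vec_inj, hY, blockDiag'_sub, Pi.sub_apply, Pi.zero_apply, sub_eq_zero,
    ← blk_mul_mul_conjTranspose, ← blk_mul_mul_conjTranspose]
  rfl

theorem exists_left_inverse_of_rank_eq {ι : Type*} [Fintype ι] {m : ℕ}
    (X : Matrix ι (Fin m) ℂ) (h : X.rank = m) : ∃ G : Matrix (Fin m) ι ℂ, G * X = 1 := by
  classical
  refine vecMul_surjective_iff_exists_left_inverse.1 fun v => ?_
  have ht : LinearMap.range Xᵀ.mulVecLin = ⊤ := by
    apply Submodule.eq_top_of_finrank_eq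
    rw [← Matrix.rank, rank_transpose, h, Module.finrank_fin_fun]
  obtain ⟨w, hw⟩ := LinearMap.range_eq_top.1 ht v
  exact ⟨w, by simpa [mulVec_transpose] using hw⟩

/-- If `0 ≤ A ≤ X X*` and `G X = 1`, then `A = X (G A G*) X*`. -/
theorem eq_mul_mul_conjTranspose_of_add_eq {ι : Type*} [Fintype ι] {m : ℕ}
    {X : Matrix ι (Fin m) ℂ} {G : Matrix (Fin m) ι ℂ} (hG : G * X = 1)
    {A B : Matrix ι ι ℂ} (hA : A.PosSemidef) (hB : B.PosSemidef) (h : X * Xᴴ = A + B) :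
    A = X * (G * A * Gᴴ) * Xᴴ := by
  classical
  have hker : ∀ v, Xᴴ *ᵥ v = 0 → A *ᵥ v = 0 := by
    intro v hv
    refine (hA.dotProduct_mulVec_zero_iff v).1 ?_
    have h0 : star v ⬝ᵥ A *ᵥ v + star v ⬝ᵥ B *ᵥ v = 0 := by
      rw [← dotProduct_add, ← add_mulVec, ← h, ← mulVec_mulVec, hv]
      simp
    exact ((add_eq_zero_iff_of_nonneg (hA.dotProduct_mulVec_nonneg v)
      (hB.dotProduct_mulVec_nonneg v)).1 h0).1
  have hGX : Xᴴ * Gᴴ = 1 := by rw [← conjTranspose_mul, hG, conjTranspose_one]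
  have hAP : A * (1 - Gᴴ * Xᴴ) = 0 := by
    refine Matrix.ext_of_mulVec_single fun i => ?_
    rw [← mulVec_mulVec, zero_mulVec]
    refine hker _ ?_
    rw [mulVec_mulVec, Matrix.mul_sub, ← Matrix.mul_assoc, hGX, Matrix.mul_one, Matrix.one_mul,
      sub_self, zero_mulVec]
  have h1 : A = A * Gᴴ * Xᴴ := by
    rw [Matrix.mul_sub, sub_eq_zero, Matrix.mul_one] at hAP
    rw [Matrix.mul_assoc, ← hAP]
  have h2 : A = X * G * A := by
    have := congrArg conjTranspose h1
    simpa [hA.1.eq, Matrix.mul_assoc] using this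
  calc A = X * G * (A * Gᴴ * Xᴴ) := by rw [← h1, ← h2]
    _ = _ := by simp only [Matrix.mul_assoc]

open scoped Matrix.Norms.L2Operator MatrixOrder in
theorem Matrix.IsHermitian.exists_pos_smul_one_add_sub_posSemidef {m : ℕ}
    {T : Matrix (Fin m) (Fin m) ℂ} (hT : T.IsHermitian) :
    ∃ c : ℝ, 0 < c ∧ (c • (1 : Matrix (Fin m) (Fin m) ℂ) + T).PosSemidef ∧
      (c • (1 : Matrix (Fin m) (Fin m) ℂ) - T).PosSemidef := by
  have hone : (1 : Matrix (Fin m) (Fin m) ℂ).PosSemidef := .one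
  have h1 := IsSelfAdjoint.le_algebraMap_norm_self (a := T) hT
  have h2 := IsSelfAdjoint.neg_algebraMap_norm_le_self (a := T) hT
  rw [Algebra.algebraMap_eq_smul_one, Matrix.le_iff] at h1 h2
  have e1 : (‖T‖ + 1) • (1 : Matrix (Fin m) (Fin m) ℂ) + T = T - -(‖T‖ • 1) + 1 := by module
  have e2 : (‖T‖ + 1) • (1 : Matrix (Fin m) (Fin m) ℂ) - T = ‖T‖ • 1 - T + 1 := by module
  exact ⟨‖T‖ + 1, by positivity, e1 ▸ h2.add hone, e2 ▸ h1.add hone⟩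

theorem real_smul_of_isHermitian {ι : Type*} {L A : Matrix ι ι ℂ} (hL0 : L ≠ 0)
    (hL : L.IsHermitian) (hA : A.IsHermitian) {c : ℂ} (h : A = c • L) :
    ∃ t : ℝ, A = t • L := by
  have hc : star c • L = c • L := by
    rw [← h, ← hA.eq, h, conjTranspose_smul, hL.eq]
  have hre : (c.re : ℂ) = c := Complex.conj_eq_iff_re.1 (smul_left_injective ℂ hL0 hc)
  refine ⟨c.re, ?_⟩
  rw [h, ← Complex.coe_smul, hre]

/-- If `X X*` is extreme, every Hermitian `T` with `X T X* ∈ 𝒲_K^⊥` is scalar. -/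
theorem exists_smul_one_of_generatesExtremeRay {d : ℕ} (nn : Fin d → ℕ)
    (K : Matrix (BIdx nn) (BIdx nn) ℂ) {m : ℕ} {X : Matrix (BIdx nn) (Fin m) ℂ}
    {G : Matrix (Fin m) (BIdx nn) ℂ} (hG : G * X = 1)
    (h1 : blockDiag' (X * Xᴴ - Kᴴ * (X * Xᴴ) * K) = 0)
    (hext : GeneratesExtremeRay {A | A ∈ WKperp nn K ∧ A.PosSemidef} (X * Xᴴ))
    {T : Matrix (Fin m) (Fin m) ℂ} (hT : T.IsHermitian)
    (hTS : blockDiag' (X * T * Xᴴ - Kᴴ * (X * T * Xᴴ) * K) = 0) :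
    ∃ c : ℂ, T = c • 1 := by
  obtain ⟨c, hc, hp, hm⟩ := hT.exists_pos_smul_one_add_sub_posSemidef
  have hGX : Xᴴ * Gᴴ = 1 := by rw [← conjTranspose_mul, hG, conjTranspose_one]
  have hmem : ∀ r s : ℝ, (r • (1 : Matrix (Fin m) (Fin m) ℂ) + s • T).PosSemidef →
      X * (r • (1 : Matrix (Fin m) (Fin m) ℂ) + s • T) * Xᴴ ∈
        {A | A ∈ WKperp nn K ∧ A.PosSemidef} := by
    intro r s hps
    have hps' := hps.mul_mul_conjTranspose_same X
    refine ⟨(mem_WKperp_iff nn K _).2 ⟨hps'.1, ?_⟩, hps'⟩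
    have : X * (r • (1 : Matrix (Fin m) (Fin m) ℂ) + s • T) * Xᴴ -
        Kᴴ * (X * (r • (1 : Matrix (Fin m) (Fin m) ℂ) + s • T) * Xᴴ) * K =
        r • (X * Xᴴ - Kᴴ * (X * Xᴴ) * K) + s • (X * T * Xᴴ - Kᴴ * (X * T * Xᴴ) * K) := by
      simp only [Matrix.mul_add, Matrix.add_mul, Matrix.mul_smul, Matrix.smul_mul, Matrix.mul_one]
      module
    rw [this, blockDiag'_add, blockDiag'_smul, blockDiag'_smul, h1, hTS]
    simp
  have hc2 : (0 : ℝ) ≤ (2 * c)⁻¹ := by positivity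
  have hhalf : (2 * c)⁻¹ * c = 1 / 2 := by field_simp
  have hp' := hmem (1 / 2) ((2 * c)⁻¹) (by
    rw [← hhalf, mul_smul, ← smul_add]; exact hp.smul hc2)
  have hm' := hmem (1 / 2) (-(2 * c)⁻¹) (by
    rw [← hhalf, mul_smul, neg_smul, ← sub_eq_add_neg, ← smul_sub]; exact hm.smul hc2)
  obtain ⟨⟨t, ht⟩, -⟩ := hext.2.2 _ hp' _ hm' (by
    rw [← Matrix.add_mul, ← Matrix.mul_add]
    have : (1 / 2 : ℝ) • (1 : Matrix (Fin m) (Fin m) ℂ) + (2 * c)⁻¹ • T +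
        ((1 / 2 : ℝ) • (1 : Matrix (Fin m) (Fin m) ℂ) + -(2 * c)⁻¹ • T) = 1 := by module
    rw [this, Matrix.mul_one])
  have hcancel : ∀ Z : Matrix (Fin m) (Fin m) ℂ, G * (X * Z * Xᴴ) * Gᴴ = Z := fun Z => by
    calc G * (X * Z * Xᴴ) * Gᴴ = (G * X) * Z * (Xᴴ * Gᴴ) := by simp only [Matrix.mul_assoc]
      _ = Z := by rw [hG, hGX, Matrix.one_mul, Matrix.mul_one]
  have hL : G * (X * Xᴴ) * Gᴴ = 1 := by
    rw [← Matrix.mul_assoc, hG, Matrix.one_mul, hGX]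
  have ht' := congrArg (fun Z => G * Z * Gᴴ) ht
  simp only [hcancel] at ht'
  rw [Matrix.mul_smul, Matrix.smul_mul, hL] at ht'
  refine ⟨((2 * c * (t - 1 / 2) : ℝ) : ℂ), ?_⟩
  rw [Complex.coe_smul, mul_smul, sub_smul, ← ht', add_sub_cancel_left, smul_smul,
    mul_inv_cancel₀ (by positivity), one_smul]

theorem stmt13 {d : ℕ} (nn : Fin d → ℕ) (hnn : ∀ j, 0 < nn j)
    (K : Matrix (BIdx nn) (BIdx nn) ℂ)
    (L : Matrix (BIdx nn) (BIdx nn) ℂ) (hL0 : L ≠ 0) (hpsd : L.PosSemidef)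
    (hLperp : L ∈ WKperp nn K) {m : ℕ} (hm : L.rank = m)
    (X : Matrix (BIdx nn) (Fin m) ℂ) (hLX : L = X * Xᴴ) :
    GeneratesExtremeRay {A | A ∈ WKperp nn K ∧ A.PosSemidef} L ↔
      Module.finrank ℂ
        ↥(⨅ j : Fin d, LinearMap.ker
          (Matrix.mulVecLin
            (((blk nn X j).map star) ⊗ₖ (blk nn X j) -
              ((blk nn (Kᴴ * X) j).map star) ⊗ₖ (blk nn (Kᴴ * X) j)))) = 1 := by
  subst hLX
  rw [rank_self_mul_conjTranspose] at hm
  obtain ⟨G, hG⟩ := exists_left_inverse_of_rank_eq X hm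
  have h1 := ((mem_WKperp_iff nn K _).1 hLperp).2
  have hone := (vec_mem_iInf_ker_iff nn K X 1).2 (by rwa [Matrix.mul_one])
  have hne : (1 : Matrix (Fin m) (Fin m) ℂ) ≠ 0 := fun h => hL0 (by
    rw [← Matrix.mul_one X, h]; simp)
  rw [finrank_eq_one_iff_of_nonzero' ⟨vec 1, hone⟩ (fun h => hne (by
    rw [Subtype.ext_iff] at h; exact vec_inj.1 h))]
  constructor
  · rintro hext ⟨v, hv⟩
    obtain ⟨T, rfl⟩ := vec_bijective.2 v
    rw [vec_mem_iInf_ker_iff] at hv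
    have hv' : blockDiag' (X * Tᴴ * Xᴴ - Kᴴ * (X * Tᴴ * Xᴴ) * K) = 0 := by
      have : X * Tᴴ * Xᴴ - Kᴴ * (X * Tᴴ * Xᴴ) * K =
          (X * T * Xᴴ - Kᴴ * (X * T * Xᴴ) * K)ᴴ := by
        simp [Matrix.mul_assoc]
      rw [this]
      funext j
      rw [blockDiag'_conjTranspose, hv]
      simp
    have hlin : ∀ a b : ℂ, blockDiag' (X * (a • T + b • Tᴴ) * Xᴴ -
        Kᴴ * (X * (a • T + b • Tᴴ) * Xᴴ) * K) = 0 := by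
      intro a b
      have : X * (a • T + b • Tᴴ) * Xᴴ - Kᴴ * (X * (a • T + b • Tᴴ) * Xᴴ) * K =
          a • (X * T * Xᴴ - Kᴴ * (X * T * Xᴴ) * K) +
            b • (X * Tᴴ * Xᴴ - Kᴴ * (X * Tᴴ * Xᴴ) * K) := by
        simp only [Matrix.mul_add, Matrix.add_mul, Matrix.mul_smul, Matrix.smul_mul]
        module
      rw [this, blockDiag'_add, blockDiag'_smul, blockDiag'_smul, hv, hv']
      simp
    have hscalar := @exists_smul_one_of_generatesExtremeRay d nn K m X G hG h1 hext
    obtain ⟨a, ha⟩ := hscalar (T := (1 : ℂ) • T + (1 : ℂ) • Tᴴ)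
      (by simp [IsHermitian, add_comm]) (hlin _ _)
    obtain ⟨b, hb⟩ := hscalar (T := Complex.I • T + (-Complex.I) • Tᴴ)
      (by simp [IsHermitian, add_comm]) (hlin _ _)
    refine ⟨(a - Complex.I * b) / 2, Subtype.ext ?_⟩
    change ((a - Complex.I * b) / 2) • vec (1 : Matrix (Fin m) (Fin m) ℂ) = vec T
    rw [← vec_smul, vec_inj]
    calc ((a - Complex.I * b) / 2) • (1 : Matrix (Fin m) (Fin m) ℂ)
        = (1 / 2 : ℂ) • (a • 1) - (Complex.I / 2) • (b • 1) := by module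
      _ = T := by
        rw [← ha, ← hb]
        ext i j
        simp only [Matrix.sub_apply, Matrix.smul_apply, Matrix.add_apply, smul_eq_mul]
        linear_combination (-(T i j) / 2 + Tᴴ i j / 2) * Complex.I_sq
  · intro hdim
    have hscalar : ∀ A ∈ {A | A ∈ WKperp nn K ∧ A.PosSemidef},
        ∀ B ∈ {A | A ∈ WKperp nn K ∧ A.PosSemidef}, X * Xᴴ = A + B →
          ∃ t : ℝ, A = t • (X * Xᴴ) := by
      rintro A ⟨hAK, hA⟩ B ⟨-, hB⟩ hAB
      have hAX := eq_mul_mul_conjTranspose_of_add_eq hG hA hB hAB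
      have hTS := (vec_mem_iInf_ker_iff nn K X (G * A * Gᴴ)).2 (by
        rw [← hAX]; exact ((mem_WKperp_iff nn K _).1 hAK).2)
      obtain ⟨c, hc⟩ := hdim ⟨_, hTS⟩
      have hc' : c • (1 : Matrix (Fin m) (Fin m) ℂ) = G * A * Gᴴ := by
        rw [← vec_inj, vec_smul]
        exact congrArg Subtype.val hc
      refine real_smul_of_isHermitian hL0 hpsd.1 hA.1 (c := c) ?_
      rw [hAX, ← hc']
      simp
    exact ⟨⟨hLperp, hpsd⟩, hL0, fun A hA B hB hAB =>
      ⟨hscalar A hA B hB hAB, hscalar B hB A hA (hAB.trans (add_comm A B))⟩⟩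
end

section
/- Let K ∈ ℂ^{n×n} with n = n₁+⋯+n_d. Let L be a nonzero positive semidefinite element of 𝒲_K^⊥, factored as L = XX* with X ∈ ℂ^{n×m} where m = rank(L), write X = col(X₁,…,X_d) with X_j ∈ ℂ^{n_j×m}, and let V₁,…,V_d ∈ ℂ^{m×m} be unitary matrices such that the j-th block of K*X equals X_j V_j for each j. If V₁,…,V_d have a common invariant subspace 𝒞 ⊆ ℂ^m with 𝒞 ≠ {0} and 𝒞 ≠ ℂ^m, then L does not generate an extreme ray of the cone 𝒲_K^⊥ ∩ PSD. -/
open Matrix Kronecker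
open scoped ComplexOrder

theorem conjTranspose_mul_blockDiagonal'_mul {d : ℕ} (nn : Fin d → ℕ) {m : ℕ}
    (H : ∀ j : Fin d, Matrix (Fin (nn j)) (Fin (nn j)) ℂ)
    (X : Matrix (BIdx nn) (Fin m) ℂ) :
    Xᴴ * Matrix.blockDiagonal' H * X = ∑ j, (blk nn X j)ᴴ * H j * blk nn X j := by
  ext a b
  simp only [Matrix.mul_apply, Matrix.sum_apply, Fintype.sum_sigma, Matrix.conjTranspose_apply, blk]
  refine Finset.sum_congr rfl fun j _ => Finset.sum_congr rfl fun k _ => ?_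
  congr 1
  rw [Finset.sum_eq_single j]
  · simp
  · intro i _ hij
    exact Finset.sum_eq_zero fun l _ => by simp [Matrix.blockDiagonal'_apply_ne H l k hij]
  · simp

/-- An invariant subspace of a unitary matrix is reducing, in terms of its orthogonal projection. -/
theorem commute_of_mem_unitaryGroup {m : ℕ} {P V : Matrix (Fin m) (Fin m) ℂ}
    (hP : Pᴴ = P) (hPP : P * P = P) (hV : V ∈ Matrix.unitaryGroup (Fin m) ℂ)
    (hinv : P * (V * P) = V * P) : V * P = P * V := by
  have h1 : Vᴴ * V = 1 := Matrix.mem_unitaryGroup_iff'.1 hV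
  have h2 : V * Vᴴ = 1 := Matrix.mem_unitaryGroup_iff.1 hV
  have hinv' : P * Vᴴ * P = P * Vᴴ := by
    simpa [Matrix.conjTranspose_mul, hP, Matrix.mul_assoc] using congrArg Matrix.conjTranspose hinv
  rw [← sub_eq_zero, ← Matrix.trace_mul_conjTranspose_self_eq_zero_iff]
  have hexp : (V * P - P * V) * (V * P - P * V)ᴴ = V * P * Vᴴ - V * P * Vᴴ * P
      - P * V * P * Vᴴ + P := by
    have e1 : V * P * (P * Vᴴ) = V * P * Vᴴ := by
      rw [Matrix.mul_assoc V P, ← Matrix.mul_assoc P P, hPP, ← Matrix.mul_assoc]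
    have e2 : P * V * (Vᴴ * P) = P := by
      rw [Matrix.mul_assoc P V, ← Matrix.mul_assoc V Vᴴ, h2, Matrix.one_mul, hPP]
    simp only [Matrix.conjTranspose_sub, Matrix.conjTranspose_mul, hP, Matrix.sub_mul,
      Matrix.mul_sub, e1, e2]
    simp only [Matrix.mul_assoc]
    abel
  have t1 : (V * P * Vᴴ).trace = P.trace := by
    rw [Matrix.trace_mul_comm, ← Matrix.mul_assoc, h1, Matrix.one_mul]
  have t2 : (V * P * Vᴴ * P).trace = P.trace := by
    rw [Matrix.mul_assoc, Matrix.mul_assoc, ← Matrix.mul_assoc P, hinv', ← Matrix.mul_assoc, t1]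
  have t3 : (P * V * P * Vᴴ).trace = P.trace := by
    rw [Matrix.mul_assoc P, hinv, t1]
  rw [hexp, Matrix.trace_add, Matrix.trace_sub, Matrix.trace_sub, t1, t2, t3]
  ring

theorem exists_orthogonalProjection_matrix {m : ℕ} (C : Submodule ℂ (Fin m → ℂ)) :
    ∃ P : Matrix (Fin m) (Fin m) ℂ, Pᴴ = P ∧ P * P = P ∧ (∀ v, P.mulVec v ∈ C) ∧
      ∀ v ∈ C, P.mulVec v = v := by
  let e := WithLp.linearEquiv 2 ℂ (Fin m → ℂ)
  let C' : Submodule ℂ (EuclideanSpace ℂ (Fin m)) := C.comap e.toLinearMap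
  let φ := Matrix.toEuclideanCLM (n := Fin m) (𝕜 := ℂ)
  have happ : ∀ v, (φ.symm C'.starProjection).mulVec v
      = WithLp.ofLp (C'.starProjection (WithLp.toLp 2 v)) := by
    intro v
    rw [← Matrix.ofLp_toEuclideanCLM]
    change WithLp.ofLp (φ (φ.symm _) _) = _
    rw [StarAlgEquiv.apply_symm_apply]
  refine ⟨φ.symm C'.starProjection, ?_, ?_, ?_, ?_⟩
  · exact (φ.symm.map_star' _).symm.trans
      (congrArg φ.symm (isSelfAdjoint_starProjection C'))
  · rw [← map_mul]
    congr 1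
    exact C'.isIdempotentElem_starProjection
  · intro v
    rw [happ]
    exact C'.starProjection_apply_mem (WithLp.toLp 2 v)
  · intro v hv
    rw [happ, Submodule.starProjection_eq_self_iff.2 (show WithLp.toLp 2 v ∈ C' from hv)]

theorem mul_mul_conjTranspose_mem {d : ℕ} (nn : Fin d → ℕ) (K : Matrix (BIdx nn) (BIdx nn) ℂ)
    {m : ℕ} (X : Matrix (BIdx nn) (Fin m) ℂ) (V : Fin d → Matrix (Fin m) (Fin m) ℂ)
    (hV : ∀ j, V j ∈ Matrix.unitaryGroup (Fin m) ℂ)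
    (hXV : ∀ j, blk nn (Kᴴ * X) j = blk nn X j * V j)
    {P : Matrix (Fin m) (Fin m) ℂ} (hP : Pᴴ = P) (hPP : P * P = P)
    (hcomm : ∀ j, V j * P = P * V j) :
    X * P * Xᴴ ∈ {A | A ∈ WKperp nn K ∧ A.PosSemidef} := by
  have hpsd : (X * P * Xᴴ).PosSemidef := by
    have : X * P * Xᴴ = (X * P) * (X * P)ᴴ := by
      rw [Matrix.conjTranspose_mul, hP, Matrix.mul_assoc, Matrix.mul_assoc, ← Matrix.mul_assoc P P,
        hPP]
    rw [this]
    exact Matrix.posSemidef_self_mul_conjTranspose _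
  refine ⟨⟨hpsd.isHermitian, ?_⟩, hpsd⟩
  rintro W ⟨H, -, rfl⟩
  set D := Matrix.blockDiagonal' H
  have e1 : (X * P * Xᴴ * D).trace = (P * (Xᴴ * D * X)).trace := by
    rw [Matrix.mul_assoc, Matrix.mul_assoc, Matrix.trace_mul_comm, Matrix.mul_assoc,
      Matrix.mul_assoc]
  have e2 : (X * P * Xᴴ * (K * D * Kᴴ)).trace
      = (P * ((Kᴴ * X)ᴴ * D * (Kᴴ * X))).trace := by
    rw [Matrix.mul_assoc, Matrix.mul_assoc, Matrix.trace_mul_comm]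
    simp [Matrix.mul_assoc]
  rw [Matrix.mul_sub, Matrix.trace_sub, e1, e2, conjTranspose_mul_blockDiagonal'_mul,
    conjTranspose_mul_blockDiagonal'_mul, sub_eq_zero, Matrix.mul_sum, Matrix.mul_sum,
    Matrix.trace_sum, Matrix.trace_sum]
  refine Finset.sum_congr rfl fun j _ => ?_
  rw [hXV]
  have h2 : V j * (V j)ᴴ = 1 := Matrix.mem_unitaryGroup_iff.1 (hV j)
  set A := (blk nn X j)ᴴ * H j * blk nn X j
  have e3 : (blk nn X j * V j)ᴴ * H j * (blk nn X j * V j) = (V j)ᴴ * (A * V j) := by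
    simp [A, Matrix.mul_assoc]
  have e4 : (P * ((V j)ᴴ * (A * V j))).trace = (P * A).trace := by
    rw [← Matrix.mul_assoc P, Matrix.trace_mul_comm, Matrix.mul_assoc A,
      ← Matrix.mul_assoc (V j), hcomm, Matrix.mul_assoc P, h2,
      Matrix.mul_one, Matrix.trace_mul_comm]
  rw [e3, e4]

/-- A matrix `X` with `rank (X Xᴴ)` equal to its number of columns can be cancelled. -/
theorem eq_of_mul_mul_conjTranspose_eq {ι : Type*} [Fintype ι] {m : ℕ}
    {X : Matrix ι (Fin m) ℂ} (hX : (X * Xᴴ).rank = m)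
    {A B : Matrix (Fin m) (Fin m) ℂ} (h : X * A * Xᴴ = X * B * Xᴴ) : A = B := by
  have hu : IsUnit (Xᴴ * X) := by
    rw [← Matrix.linearIndependent_cols_iff_isUnit,
      linearIndependent_iff_card_eq_finrank_span, Set.finrank, ← Matrix.rank_eq_finrank_span_cols]
    simpa [eq_comm, Matrix.rank_conjTranspose_mul_self, Matrix.rank_self_mul_conjTranspose] using hX
  refine hu.mul_left_cancel (hu.mul_right_cancel ?_)
  simpa only [Matrix.mul_assoc] using congrArg (fun M => Xᴴ * M * X) h

theorem stmt15 {d : ℕ} (nn : Fin d → ℕ) (hnn : ∀ j, 0 < nn j)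
    (K : Matrix (BIdx nn) (BIdx nn) ℂ)
    (L : Matrix (BIdx nn) (BIdx nn) ℂ) (hL0 : L ≠ 0) (hpsd : L.PosSemidef)
    (hLperp : L ∈ WKperp nn K) {m : ℕ} (hm : L.rank = m)
    (X : Matrix (BIdx nn) (Fin m) ℂ) (hLX : L = X * Xᴴ)
    (V : ∀ _ : Fin d, Matrix (Fin m) (Fin m) ℂ)
    (hV : ∀ j, V j ∈ Matrix.unitaryGroup (Fin m) ℂ)
    (hXV : ∀ j, blk nn (Kᴴ * X) j = blk nn X j * V j)
    (C : Submodule ℂ (Fin m → ℂ)) (hCbot : C ≠ ⊥) (hCtop : C ≠ ⊤)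
    (hCinv : ∀ j, ∀ v ∈ C, (V j).mulVec v ∈ C) :
    ¬ GeneratesExtremeRay {A | A ∈ WKperp nn K ∧ A.PosSemidef} L := by
  rintro ⟨-, -, hext⟩
  obtain ⟨P, hP, hPP, hPmem, hPfix⟩ := exists_orthogonalProjection_matrix C
  have hcomm : ∀ j, V j * P = P * V j := fun j => by
    refine commute_of_mem_unitaryGroup hP hPP (hV j) (Matrix.ext_of_mulVec_single fun i => ?_)
    rw [← Matrix.mulVec_mulVec]
    exact hPfix _ (by rw [← Matrix.mulVec_mulVec]; exact hCinv j _ (hPmem _))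
  have h1 := mul_mul_conjTranspose_mem nn K X V hV hXV hP hPP hcomm
  have h2 := mul_mul_conjTranspose_mem nn K X V hV hXV (P := 1 - P)
    (by simp [hP]) (by simp [Matrix.mul_sub, Matrix.sub_mul, hPP])
    (fun j => by simp [Matrix.mul_sub, Matrix.sub_mul, hcomm])
  obtain ⟨⟨t, ht⟩, -⟩ := hext _ h1 _ h2 (by
    rw [hLX, ← Matrix.add_mul, ← Matrix.mul_add, add_sub_cancel, Matrix.mul_one])
  have hPt : P = t • (1 : Matrix (Fin m) (Fin m) ℂ) := by
    refine eq_of_mul_mul_conjTranspose_eq (hLX ▸ hm) ?_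
    rw [ht, hLX]
    simp
  obtain ⟨v, hv, hv0⟩ := C.ne_bot_iff.1 hCbot
  have htv : t • v = v := by
    simpa [hPt, Matrix.smul_mulVec] using hPfix v hv
  have ht1 : t = 1 := by
    have h : (t - 1) • v = 0 := by rw [sub_smul, htv, one_smul, sub_self]
    exact sub_eq_zero.1 ((smul_eq_zero.1 h).resolve_right hv0)
  refine hCtop (eq_top_iff.2 fun w _ => ?_)
  simpa [hPt, ht1] using hPmem w
end

section
/- Let K ∈ ℂ^{n×n} with n = n₁+⋯+n_d and let c ∈ ℂ be nonzero. If K is a strict J-contraction for some diagonal signature matrix J, then the polynomial p(z₁,…,z_d) = c·det(I_n − K(⊕_{j=1}^d z_j I_{n_j})) has no roots on the d-torus 𝕋^d = {(z₁,…,z_d) ∈ ℂ^d : |z_j| = 1 for all j}. -/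
open Matrix Kronecker
open scoped ComplexOrder

/-- A diagonal signature matrix: a diagonal matrix with each diagonal entry `1` or `-1`. -/
def IsDiagSignature {ι : Type*} [DecidableEq ι] (J : Matrix ι ι ℂ) : Prop :=
  ∃ e : ι → ℂ, (∀ i, e i = 1 ∨ e i = -1) ∧ J = Matrix.diagonal e

/-- The polynomial `p(z₁,…,z_d) = c · det(I_n − K (⊕_{j=1}^d z_j I_{n_j}))`. -/
noncomputable def polyDet {d : ℕ} (nn : Fin d → ℕ)
    (K : Matrix (BIdx nn) (BIdx nn) ℂ) (c : ℂ) (z : Fin d → ℂ) : ℂ :=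
  c * Matrix.det ((1 : Matrix (BIdx nn) (BIdx nn) ℂ) -
      K * Matrix.diagonal (fun i : BIdx nn => z i.1))

/-- If `M` is a strict `J`-contraction, then `1` is not an eigenvalue of `M`. -/
theorem det_one_sub_ne_zero_of_posDef {ι : Type*} [Fintype ι] [DecidableEq ι]
    {J M : Matrix ι ι ℂ} (h : (J - M * J * Mᴴ).PosDef) : (1 - M).det ≠ 0 := by
  intro hdet
  have hdet' : ((1 - M)ᴴ).det = 0 := by rw [det_conjTranspose, hdet, star_zero]
  obtain ⟨w, hw, hw0⟩ := exists_mulVec_eq_zero_iff.mpr hdet'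
  have hMw : Mᴴ *ᵥ w = w := by
    rw [conjTranspose_sub, conjTranspose_one, sub_mulVec, one_mulVec, sub_eq_zero] at hw0
    exact hw0.symm
  have hMw' : star w ᵥ* M = star w := by
    simpa [star_mulVec] using congrArg star hMw
  have hpos := h.dotProduct_mulVec_pos hw
  rw [sub_mulVec, dotProduct_sub, ← mulVec_mulVec, hMw, ← mulVec_mulVec,
    dotProduct_mulVec (star w) M, hMw', sub_self] at hpos
  exact lt_irrefl _ hpos

/-- Conjugating a diagonal matrix by a diagonal matrix with unimodular entries leaves it unchanged. -/
theorem diagonal_mul_diagonal_mul_conjTranspose {ι : Type*} [Fintype ι] [DecidableEq ι]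
    (u e : ι → ℂ) (hu : ∀ i, ‖u i‖ = 1) :
    diagonal u * diagonal e * (diagonal u)ᴴ = diagonal e := by
  rw [diagonal_conjTranspose, diagonal_mul_diagonal, diagonal_mul_diagonal]
  congr 1
  funext i
  have h : u i * star (u i) = 1 := by
    simp [Complex.mul_conj, Complex.normSq_eq_norm_sq, hu i]
  rw [Pi.star_apply, mul_right_comm, h, one_mul]

theorem stmt17 {d : ℕ} (nn : Fin d → ℕ) (hnn : ∀ j, 0 < nn j)
    (K : Matrix (BIdx nn) (BIdx nn) ℂ) (c : ℂ) (hc : c ≠ 0)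
    (J : Matrix (BIdx nn) (BIdx nn) ℂ) (hJ : IsDiagSignature J)
    (hK : (J - K * J * Kᴴ).PosDef) :
    ∀ z : Fin d → ℂ, (∀ j, ‖z j‖ = 1) → polyDet nn K c z ≠ 0 := by
  intro z hz
  obtain ⟨e, -, rfl⟩ := hJ
  refine mul_ne_zero hc (det_one_sub_ne_zero_of_posDef (J := diagonal e) ?_)
  have hZ := diagonal_mul_diagonal_mul_conjTranspose (fun i : BIdx nn => z i.1) e
    fun i => hz i.1
  convert hK using 2
  rw [conjTranspose_mul, ← Matrix.mul_assoc, Matrix.mul_assoc K, Matrix.mul_assoc K, hZ]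
end
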